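/- Let r2 : ℝ → ℝ³ be three times continuously differentiable with ‖r2' s‖ ≤ v1 for all s ∈ ℝ, where 0 ≤ v1 < 1. Define on G the field E = −u·z²·a + u·z³·⟨e,a⟩·e − u·z³·⟨e,a⟩·v + u²·z³·e − u²·z³·⟨v,v⟩·e − u²·z³·v + u²·z³·⟨v,v⟩·v, and B = e × E (cross product in ℝ³). Then the Faraday equation holds on G: ∇ × E = −DB, i.e. (D₂E₃ − D₃E₂, D₃E₁ − D₁E₃, D₁E₂ − D₂E₁) = −(DB₁, DB₂, DB₃) at every point of G. -/

import Mathlib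

open scoped RealInnerProductSpace

/-- Partial derivative with respect to time of a scalar field on `ℝ³ × ℝ`. -/
noncomputable def Dt (f : EuclideanSpace ℝ (Fin 3) × ℝ → ℝ)
    (p : EuclideanSpace ℝ (Fin 3) × ℝ) : ℝ :=
  deriv (fun s : ℝ => f (p.1, s)) p.2

/-- Partial derivative with respect to the `i`-th space coordinate of a scalar
field on `ℝ³ × ℝ`. -/
noncomputable def Dx (i : Fin 3) (f : EuclideanSpace ℝ (Fin 3) × ℝ → ℝ)
    (p : EuclideanSpace ℝ (Fin 3) × ℝ) : ℝ :=
  deriv (fun h : ℝ => f (p.1 + h • EuclideanSpace.single i (1 : ℝ), p.2)) 0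


theorem hasFDerivAt_norm_of_ne_zero {V : Type*} [NormedAddCommGroup V] [InnerProductSpace ℝ V]
    {x : V} (hx : x ≠ 0) : HasFDerivAt (fun y : V => ‖y‖) (‖x‖⁻¹ • innerSL ℝ x) x := by
  have h := (hasStrictFDerivAt_norm_sq x).hasFDerivAt.sqrt
    (pow_ne_zero 2 (norm_ne_zero_iff.mpr hx))
  simp only [Real.sqrt_sq (norm_nonneg _)] at h
  refine h.congr_fderiv ?_
  ext y
  simp
  field_simp

/-- The retarded time is differentiable off the trajectory. -/
theorem hasFDerivAt_retardedTime {V : Type*} [NormedAddCommGroup V] [InnerProductSpace ℝ V]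
    {r : ℝ → V} {κ : ℝ} (hκ : κ < 1) (hr : ∀ s s', ‖r s - r s'‖ ≤ κ * |s - s'|)
    {τ : V × ℝ → ℝ} (hτ : ∀ p, τ p = p.2 - ‖p.1 - r (τ p)‖) {p : V × ℝ} {w : V}
    (hw : HasDerivAt r w (τ p)) (hp : p.1 - r (τ p) ≠ 0) {z : ℝ}
    (hz : z * (1 - ⟪‖p.1 - r (τ p)‖⁻¹ • (p.1 - r (τ p)), w⟫) = 1) :
    HasFDerivAt τ (z • (ContinuousLinearMap.snd ℝ V ℝ -
      (innerSL ℝ (‖p.1 - r (τ p)‖⁻¹ • (p.1 - r (τ p)))).comp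
        (ContinuousLinearMap.fst ℝ V ℝ))) p := by
  have hlip : ∀ q, |τ q - τ p| ≤ 2 / (1 - κ) * ‖q - p‖ := by
    intro q
    have h1 : τ q - τ p = (q.2 - p.2) - (‖q.1 - r (τ q)‖ - ‖p.1 - r (τ p)‖) := by
      linarith [hτ q, hτ p]
    have h2 := abs_norm_sub_norm_le (q.1 - r (τ q)) (p.1 - r (τ p))
    have h3 : ‖q.1 - r (τ q) - (p.1 - r (τ p))‖ ≤ ‖q.1 - p.1‖ + ‖r (τ q) - r (τ p)‖ := by
      rw [show q.1 - r (τ q) - (p.1 - r (τ p)) = (q.1 - p.1) - (r (τ q) - r (τ p)) by abel]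
      exact norm_sub_le _ _
    have h4 : ‖q.1 - p.1‖ ≤ ‖q - p‖ := norm_fst_le (q - p)
    have h5 : |q.2 - p.2| ≤ ‖q - p‖ := norm_snd_le (q - p)
    have h6 := hr (τ q) (τ p)
    have h7 := abs_sub (q.2 - p.2) (‖q.1 - r (τ q)‖ - ‖p.1 - r (τ p)‖)
    rw [← h1] at h7
    rw [div_mul_eq_mul_div, le_div_iff₀ (by linarith)]
    linarith
  have hO : (fun q => (q - p, τ q - τ p)) =O[nhds p] fun q => q - p :=
    (Asymptotics.isBigO_refl _ _).prod_left
      (Asymptotics.IsBigO.of_bound _ (.of_forall hlip))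
  have hcont : Filter.Tendsto (fun q => (q, τ q)) (nhds p) (nhds (p, τ p)) := by
    refine Filter.tendsto_id.prodMk_nhds ?_
    rw [tendsto_iff_norm_sub_tendsto_zero]
    refine squeeze_zero (fun _ => norm_nonneg _) hlip ?_
    have : Continuous fun q : V × ℝ => 2 / (1 - κ) * ‖q - p‖ := by fun_prop
    simpa using this.tendsto p
  have hdiff : HasFDerivAt (fun y : (V × ℝ) × ℝ => y.1.1 - r y.2)
      ((ContinuousLinearMap.fst ℝ V ℝ).comp (ContinuousLinearMap.fst ℝ (V × ℝ) ℝ) -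
        (ContinuousLinearMap.toSpanSingleton ℝ w).comp (ContinuousLinearMap.snd ℝ (V × ℝ) ℝ))
      (p, τ p) :=
    (hasFDerivAt_fst.comp (p, τ p) hasFDerivAt_fst).sub
      (HasFDerivAt.comp (p, τ p) hw.hasFDerivAt hasFDerivAt_snd)
  have hF := (hasFDerivAt_snd.sub (hasFDerivAt_snd.comp (p, τ p) hasFDerivAt_fst)).add
    ((hasFDerivAt_norm_of_ne_zero hp).comp (p, τ p) hdiff)
  have ho := ((hasFDerivAt_iff_isLittleO.mp hF).comp_tendsto hcont).trans_isBigO hO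
  refine hasFDerivAt_iff_isLittleO.mpr ((ho.const_mul_left (-z)).congr_left fun q => ?_)
  have hq := hτ q
  have hp' := hτ p
  simp [inner_sub_left, inner_sub_right, inner_smul_left] at hz ⊢
  set n := ‖p.1 - r (τ p)‖
  set m := ‖q.1 - r (τ q)‖
  linear_combination (-z) * (hq - hp') + (τ q - τ p) * hz

/-- The derivative along a curve of the electric field, expressed through `u`, `z`, `e`, `v`, `a`. -/
theorem hasDerivAt_electricField {V : Type*} [NormedAddCommGroup V] [InnerProductSpace ℝ V]
    {u z : ℝ → ℝ} {e v a : ℝ → V} {u' z' : ℝ} {e' v' a' : V} {x : ℝ}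
    (hu : HasDerivAt u u' x) (hz : HasDerivAt z z' x) (he : HasDerivAt e e' x)
    (hv : HasDerivAt v v' x) (ha : HasDerivAt a a' x) :
    HasDerivAt (fun h => (-(u h * z h ^ 2)) • a h
        + (u h * z h ^ 3 * ⟪e h, a h⟫) • e h
        - (u h * z h ^ 3 * ⟪e h, a h⟫) • v h
        + (u h ^ 2 * z h ^ 3) • e h
        - (u h ^ 2 * z h ^ 3 * ⟪v h, v h⟫) • e h
        - (u h ^ 2 * z h ^ 3) • v h
        + (u h ^ 2 * z h ^ 3 * ⟪v h, v h⟫) • v h)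
      (-(u' * z x ^ 2 + 2 * u x * z x * z') • a x - (u x * z x ^ 2) • a'
        + (u' * z x ^ 3 * ⟪e x, a x⟫ + 3 * u x * z x ^ 2 * z' * ⟪e x, a x⟫
            + u x * z x ^ 3 * (⟪e x, a'⟫ + ⟪e', a x⟫)
            + (2 * u x * u' * z x ^ 3 + 3 * u x ^ 2 * z x ^ 2 * z') * (1 - ⟪v x, v x⟫)
            - 2 * u x ^ 2 * z x ^ 3 * ⟪v x, v'⟫) • (e x - v x)
        + (u x * z x ^ 3 * ⟪e x, a x⟫ + u x ^ 2 * z x ^ 3 * (1 - ⟪v x, v x⟫)) • (e' - v')) x := by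
  have hs := he.inner ℝ ha
  have hq := hv.inner ℝ hv
  have h2 := hu.mul (hz.pow 3)
  have h3 := (hu.pow 2).mul (hz.pow 3)
  have h := (((((((hu.mul (hz.pow 2)).neg.smul ha).add ((h2.mul hs).smul he)).sub
    ((h2.mul hs).smul hv)).add (h3.smul he)).sub ((h3.mul hq).smul he)).sub
    (h3.smul hv)).add ((h3.mul hq).smul hv)
  refine h.congr_deriv ?_
  simp only [Pi.mul_apply, Pi.pow_apply, Pi.neg_apply, real_inner_comm (v x) v']
  push_cast
  module

/-- with `B = e × E`, the Faraday equation `∇ × E = −DB`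
holds on `G` (componentwise). -/
theorem faraday_equation
    (r2 : ℝ → EuclideanSpace ℝ (Fin 3)) (v1 : ℝ)
    (hv0 : 0 ≤ v1) (hv1 : v1 < 1)
    (hC3 : ContDiff ℝ 3 r2) (hbd : ∀ s : ℝ, ‖deriv r2 s‖ ≤ v1)
    (τ : EuclideanSpace ℝ (Fin 3) × ℝ → ℝ)
    (hτ : ∀ p : EuclideanSpace ℝ (Fin 3) × ℝ, τ p = p.2 - ‖p.1 - r2 (τ p)‖)
    (T : EuclideanSpace ℝ (Fin 3) × ℝ → ℝ)
    (hT : ∀ p, T p = p.2 - τ p)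
    (u : EuclideanSpace ℝ (Fin 3) × ℝ → ℝ)
    (hu : ∀ p, u p = (T p)⁻¹)
    (e : EuclideanSpace ℝ (Fin 3) × ℝ → EuclideanSpace ℝ (Fin 3))
    (he : ∀ p, e p = (T p)⁻¹ • (p.1 - r2 (τ p)))
    (v : EuclideanSpace ℝ (Fin 3) × ℝ → EuclideanSpace ℝ (Fin 3))
    (hv : ∀ p, v p = deriv r2 (τ p))
    (a : EuclideanSpace ℝ (Fin 3) × ℝ → EuclideanSpace ℝ (Fin 3))
    (ha : ∀ p, a p = deriv (deriv r2) (τ p))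
    (z : EuclideanSpace ℝ (Fin 3) × ℝ → ℝ)
    (hz : ∀ p, z p = (1 - ⟪e p, v p⟫)⁻¹)
    (E : EuclideanSpace ℝ (Fin 3) × ℝ → EuclideanSpace ℝ (Fin 3))
    (hE : ∀ p, E p =
      (-(u p * z p ^ 2)) • a p
        + (u p * z p ^ 3 * ⟪e p, a p⟫) • e p
        - (u p * z p ^ 3 * ⟪e p, a p⟫) • v p
        + (u p ^ 2 * z p ^ 3) • e p
        - (u p ^ 2 * z p ^ 3 * ⟪v p, v p⟫) • e p
        - (u p ^ 2 * z p ^ 3) • v p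
        + (u p ^ 2 * z p ^ 3 * ⟪v p, v p⟫) • v p)
    (B : EuclideanSpace ℝ (Fin 3) × ℝ → Fin 3 → ℝ)
    (hB : ∀ p, B p =
      ![e p 1 * E p 2 - e p 2 * E p 1,
        e p 2 * E p 0 - e p 0 * E p 2,
        e p 0 * E p 1 - e p 1 * E p 0])
    (r1 : EuclideanSpace ℝ (Fin 3)) (t : ℝ)
    (hG : 0 < T (r1, t)) :
    Dx 1 (fun p => E p 2) (r1, t) - Dx 2 (fun p => E p 1) (r1, t) =
        -(Dt (fun p => B p 0) (r1, t)) ∧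
      Dx 2 (fun p => E p 0) (r1, t) - Dx 0 (fun p => E p 2) (r1, t) =
        -(Dt (fun p => B p 1) (r1, t)) ∧
      Dx 0 (fun p => E p 1) (r1, t) - Dx 1 (fun p => E p 0) (r1, t) =
        -(Dt (fun p => B p 2) (r1, t)) := by
  have hκ : ∀ s s', ‖r2 s - r2 s'‖ ≤ v1 * |s - s'| := fun s s' =>
    Convex.norm_image_sub_le_of_norm_deriv_le
      (fun x _ => (hC3.differentiable (by norm_num)) x) (fun x _ => hbd x) convex_univ
      (Set.mem_univ s') (Set.mem_univ s)
  have hC2 : ContDiff ℝ 2 (deriv r2) := (contDiff_succ_iff_deriv.mp hC3).2.2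
  have hC1 : ContDiff ℝ 1 (deriv (deriv r2)) := (contDiff_succ_iff_deriv.mp hC2).2.2
  set p : EuclideanSpace ℝ (Fin 3) × ℝ := (r1, t)
  have hTn : T p = ‖p.1 - r2 (τ p)‖ := by linarith [hT p, hτ p]
  have hn : p.1 - r2 (τ p) ≠ 0 := norm_pos_iff.mp (hTn ▸ hG)
  have hen : ‖e p‖ = 1 := by
    rw [he, norm_smul, ← hTn, norm_inv, Real.norm_of_nonneg hG.le, inv_mul_cancel₀ hG.ne']
  have hw1 : 0 < 1 - ⟪e p, v p⟫ := by
    have := real_inner_le_norm (e p) (v p)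
    have := hbd (τ p)
    rw [← hv] at this
    rw [hen] at *
    linarith
  have hzp : z p * (1 - ⟪e p, v p⟫) = 1 := by rw [hz, inv_mul_cancel₀ hw1.ne']
  have hz0 : z p ≠ 0 := left_ne_zero_of_mul_eq_one hzp
  have hτ' := hasFDerivAt_retardedTime hv1 hκ hτ
    ((hC3.differentiable (by norm_num)) (τ p)).hasDerivAt hn (z := z p)
    (by rw [← hTn, ← he, ← hv, hzp])
  rw [← hTn, ← he] at hτ'
  set j := deriv (deriv (deriv r2)) (τ p)
  have fields : ∀ (X : EuclideanSpace ℝ (Fin 3) × ℝ) (k : ℝ), k = z p * (X.2 - ⟪e p, X.1⟫) →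
      ∃ (u' z' : ℝ) (e' E' : EuclideanSpace ℝ (Fin 3)),
        u' = -(u p ^ 2 * (X.2 - k)) ∧
        e' = u p • (X.1 - k • v p) - (u p * (X.2 - k)) • e p ∧
        z' = z p ^ 2 * (⟪e p, k • a p⟫ + ⟪e', v p⟫) ∧
        E' = -(u' * z p ^ 2 + 2 * u p * z p * z') • a p - (u p * z p ^ 2) • k • j
          + (u' * z p ^ 3 * ⟪e p, a p⟫ + 3 * u p * z p ^ 2 * z' * ⟪e p, a p⟫
              + u p * z p ^ 3 * (⟪e p, k • j⟫ + ⟪e', a p⟫)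
              + (2 * u p * u' * z p ^ 3 + 3 * u p ^ 2 * z p ^ 2 * z') * (1 - ⟪v p, v p⟫)
              - 2 * u p ^ 2 * z p ^ 3 * ⟪v p, k • a p⟫) • (e p - v p)
          + (u p * z p ^ 3 * ⟪e p, a p⟫ + u p ^ 2 * z p ^ 3 * (1 - ⟪v p, v p⟫)) •
              (e' - k • a p) ∧
        HasDerivAt (fun h : ℝ => e (p + h • X)) e' 0 ∧
        HasDerivAt (fun h : ℝ => E (p + h • X)) E' 0 := by
    intro X k hk
    have p0 : p + (0 : ℝ) • X = p := by simp
    have dτ : HasDerivAt (fun h : ℝ => τ (p + h • X)) k 0 :=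
      (hτ'.hasLineDerivAt X).congr_deriv (by simp [hk])
    have dX₁ : HasDerivAt (fun h : ℝ => (p + h • X).1) X.1 0 := by
      simpa using ((hasDerivAt_id (0 : ℝ)).smul_const X.1).const_add p.1
    have dX₂ : HasDerivAt (fun h : ℝ => (p + h • X).2) X.2 0 := by
      simpa using ((hasDerivAt_id (0 : ℝ)).mul_const X.2).const_add p.2
    have along : ∀ {f : ℝ → EuclideanSpace ℝ (Fin 3)}, Differentiable ℝ f →
        HasDerivAt (fun h : ℝ => f (τ (p + h • X))) (k • deriv f (τ p)) 0 := by
      intro f hf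
      have := HasDerivAt.scomp_of_eq (0 : ℝ) (hf (τ p)).hasDerivAt dτ (by rw [p0])
      exact this
    have dT : HasDerivAt (fun h : ℝ => T (p + h • X)) (X.2 - k) 0 := by
      simp only [hT]
      exact dX₂.sub dτ
    have du : HasDerivAt (fun h : ℝ => u (p + h • X)) (-(u p ^ 2 * (X.2 - k))) 0 := by
      have := dT.inv (by rw [p0]; exact hG.ne')
      simp only [hu]
      refine this.congr_deriv ?_
      rw [p0]; field_simp
    have de : HasDerivAt (fun h : ℝ => e (p + h • X))
        (u p • (X.1 - k • v p) - (u p * (X.2 - k)) • e p) 0 := by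
      have := du.smul (dX₁.sub (along (hC3.differentiable (by norm_num))))
      simp only [hu] at this
      simp only [he]
      refine this.congr_deriv ?_
      simp only [p0, hu, ← hv, Pi.sub_apply]
      module
    have dv : HasDerivAt (fun h : ℝ => v (p + h • X)) (k • a p) 0 := by
      simp only [hv, ha]
      exact along (hC2.differentiable (by norm_num))
    have da : HasDerivAt (fun h : ℝ => a (p + h • X)) (k • j) 0 := by
      simp only [ha]
      exact along (hC1.differentiable (by norm_num))
    have dz : HasDerivAt (fun h : ℝ => z (p + h • X)) (z p ^ 2 * (⟪e p, k • a p⟫ +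
        ⟪u p • (X.1 - k • v p) - (u p * (X.2 - k)) • e p, v p⟫)) 0 := by
      have := ((de.inner ℝ dv).const_sub 1).inv (by rw [p0]; exact hw1.ne')
      simp only [hz (_ + _)]
      refine this.congr_deriv ?_
      rw [p0, hz]; field_simp
    have dE := hasDerivAt_electricField du dz de dv da
    simp only [← hE, p0] at dE
    exact ⟨_, _, _, _, rfl, rfl, rfl, rfl, de, dE⟩
  have coord : ∀ {f : ℝ → EuclideanSpace ℝ (Fin 3)} {f' : EuclideanSpace ℝ (Fin 3)} {x : ℝ},
      HasDerivAt f f' x → ∀ i, HasDerivAt (fun h => f h i) (f' i) x := fun h i =>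
    (EuclideanSpace.proj i : EuclideanSpace ℝ (Fin 3) →L[ℝ] ℝ).hasFDerivAt.comp_hasDerivAt _ h
  have space : ∀ i k : Fin 3, ∀ {E' : EuclideanSpace ℝ (Fin 3)},
      HasDerivAt (fun h : ℝ => E (p + h • (EuclideanSpace.single i (1 : ℝ), (0 : ℝ)))) E' 0 →
      Dx i (fun q => E q k) p = E' k := by
    intro i k E' h
    have h' := (coord h k).deriv
    rw [← h']
    simp [Dx, Prod.add_def]
  obtain ⟨u₀, z₀, e₀, E₀, hu₀, he₀, hz₀, hE₀, -, d₀⟩ :=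
    fields (EuclideanSpace.single 0 1, 0) (-(z p * e p 0)) (by simp [EuclideanSpace.inner_single_right])
  obtain ⟨u₁, z₁, e₁, E₁, hu₁, he₁, hz₁, hE₁, -, d₁⟩ :=
    fields (EuclideanSpace.single 1 1, 0) (-(z p * e p 1)) (by simp [EuclideanSpace.inner_single_right])
  obtain ⟨u₂, z₂, e₂, E₂, hu₂, he₂, hz₂, hE₂, -, d₂⟩ :=
    fields (EuclideanSpace.single 2 1, 0) (-(z p * e p 2)) (by simp [EuclideanSpace.inner_single_right])
  obtain ⟨u₃, z₃, e₃, E₃, hu₃, he₃, hz₃, hE₃, de, dE⟩ :=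
    fields (0, 1) (z p) (by simp)
  have cross : ∀ i k : Fin 3, Dt (fun q => e q i * E q k - e q k * E q i) p =
      e₃ i * E p k + e p i * E₃ k - (e₃ k * E p i + e p k * E₃ i) := by
    intro i k
    have h := ((coord de i).mul (coord dE k)).sub
      ((coord de k).mul (coord dE i))
    have h' := h.deriv
    simp only [zero_smul, add_zero] at h'
    rw [← h', Dt, ← add_zero p.2, ← deriv_comp_const_add]
    simp [Prod.add_def, Pi.mul_def, Pi.sub_def]
  have hw : ⟪e p, v p⟫ = 1 - (z p)⁻¹ := by rw [hz]; simp
  have hva : ⟪v p, a p⟫ = ⟪a p, v p⟫ := real_inner_comm _ _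
  simp only [hB, Matrix.cons_val, space 0 1 d₀, space 0 2 d₀, space 1 0 d₁, space 1 2 d₁,
    space 2 0 d₂, space 2 1 d₂, cross]
  subst hu₀ he₀ hz₀ hE₀ hu₁ he₁ hz₁ hE₁ hu₂ he₂ hz₂ hE₂ hu₃ he₃ hz₃ hE₃
  rw [hE p]
  simp only [inner_sub_left, inner_smul_left, inner_smul_right, inner_zero_left, hva, hw,
    EuclideanSpace.inner_single_left, PiLp.add_apply, PiLp.sub_apply, PiLp.smul_apply,
    PiLp.zero_apply, PiLp.single_apply, smul_eq_mul, map_one, conj_trivial]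
  generalize ⟪e p, a p⟫ = s, ⟪v p, v p⟫ = q, ⟪a p, v p⟫ = b, ⟪e p, j⟫ = c
  simp only [Fin.isValue, Fin.reduceEq, if_false]
  refine ⟨?_, ?_, ?_⟩ <;> field_simp <;> ring
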